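/- (Mittag-Leffler-type criterion) Let I be a directed partially ordered set and (X_i)_{i∈I} an inverse system of non-empty sets with transition maps f_j^i for j ≤ i. Suppose for each i there is a family S_i of subsets of X_i such that: (1) each S_i is closed under arbitrary intersections; (2) each S_i has the finite intersection property: if F ⊆ S_i and every finite subfamily of F has non-empty intersection, then ∩F ≠ ∅; (3) preimages of points under transition maps belong to S_i: for j ≤ i and x ∈ X_j, (f_j^i)^{-1}(x) ∈ S_i; (4) images of members of S_i under transition maps lie in S_j: for j ≤ i and Y ∈ S_i, f_j^i(Y) ∈ S_j. Then lim_{i∈I} X_i ≠ ∅. -/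

import Mathlib

/-- A nonempty downward directed family of nonempty members of a class of sets with the finite
intersection property has nonempty intersection. -/
theorem nonempty_iInter_of_directed_of_finite_inter {α ι : Type*} [Nonempty ι]
    {S : Set (Set α)}
    (hS : ∀ F : Set (Set α), F ⊆ S →
      (∀ F' ⊆ F, F'.Finite → (⋂₀ F').Nonempty) → (⋂₀ F).Nonempty)
    (B : ι → Set α) (hB : ∀ n, B n ∈ S) (hne : ∀ n, (B n).Nonempty)
    (hdir : Directed (· ⊇ ·) B) : (⋂ n, B n).Nonempty := by
  rw [← Set.sInter_range]
  refine hS _ (Set.range_subset_iff.2 hB) fun F' hF' hfin => ?_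
  suffices h : ∃ n, B n ⊆ ⋂₀ F' by
    obtain ⟨n, hn⟩ := h
    exact (hne n).mono hn
  induction F', hfin using Set.Finite.induction_on with
  | empty => exact ⟨Classical.arbitrary ι, by simp⟩
  | insert _ _ ih =>
    rw [Set.insert_subset_iff] at hF'
    obtain ⟨n, hn⟩ := ih hF'.2
    obtain ⟨⟨m, rfl⟩, -⟩ := hF'
    obtain ⟨k, hkn, hkm⟩ := hdir n m
    refine ⟨k, ?_⟩
    rw [Set.sInter_insert]
    exact Set.subset_inter hkm (hkn.trans hn)


/-- **Bourbaki's criterion for nonemptiness of an inverse limit of sets.**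
Let `I` be a directed poset and `(X i)` an inverse system of nonempty sets with
transition maps `f_j^i`.  Suppose each `X i` carries a family `S i` of subsets
closed under arbitrary intersections, having the finite intersection property,
containing all fibers of transition maps, and stable under images along transition
maps.  Then the inverse limit is nonempty. -/
theorem statement11 {I : Type*} [Preorder I] [IsDirected I (· ≤ ·)]
    (X : I → Type*) (hne : ∀ i, Nonempty (X i))
    (f : ∀ ⦃j i : I⦄, j ≤ i → X i → X j)
    (hrefl : ∀ (i : I) (h : i ≤ i) (x : X i), f h x = x)
    (htrans : ∀ ⦃k j i : I⦄ (hkj : k ≤ j) (hji : j ≤ i) (x : X i),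
      f hkj (f hji x) = f (hkj.trans hji) x)
    (S : ∀ i, Set (Set (X i)))
    -- (1) each `S i` is closed under arbitrary intersections
    (h1 : ∀ (i : I) (F : Set (Set (X i))), F ⊆ S i → ⋂₀ F ∈ S i)
    -- (2) finite intersection property
    (h2 : ∀ (i : I) (F : Set (Set (X i))), F ⊆ S i →
      (∀ F' ⊆ F, F'.Finite → (⋂₀ F').Nonempty) → (⋂₀ F).Nonempty)
    -- (3) fibers of transition maps belong to `S i`
    (h3 : ∀ ⦃j i : I⦄ (h : j ≤ i) (x : X j), f h ⁻¹' {x} ∈ S i)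
    -- (4) images of members of `S i` lie in `S j`
    (h4 : ∀ ⦃j i : I⦄ (h : j ≤ i), ∀ Y ∈ S i, f h '' Y ∈ S j) :
    ∃ x : ∀ i, X i, ∀ ⦃j i : I⦄ (h : j ≤ i), f h (x i) = x j := by
  have hinter : ∀ (i : I) (s t : Set (X i)), s ∈ S i → t ∈ S i → s ∩ t ∈ S i := by
    intro i s t hs ht
    rw [← Set.sInter_pair]
    exact h1 i _ (Set.pair_subset hs ht)
  let P : Set (∀ i, Set (X i))ᵒᵈ := {A | (∀ i, OrderDual.ofDual A i ∈ S i) ∧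
    (∀ i, (OrderDual.ofDual A i).Nonempty) ∧
    ∀ ⦃j i : I⦄ (h : j ≤ i), ∀ x ∈ OrderDual.ofDual A i, f h x ∈ OrderDual.ofDual A j}
  have hzorn : ∃ A, Maximal (· ∈ P) A := by
    refine zorn_le₀ P fun c hcP hc => ?_
    rcases c.eq_empty_or_nonempty with rfl | hcne
    · refine ⟨OrderDual.toDual fun i => Set.univ, ⟨fun i => ?_, fun i => ?_, ?_⟩, by simp⟩
      · simpa using h1 i ∅ (Set.empty_subset _)
      · have := hne i
        exact Set.univ_nonempty
      · simp
    · have : Nonempty c := hcne.to_subtype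
      refine ⟨OrderDual.toDual fun i => ⋂ A : c, OrderDual.ofDual A.1 i,
        ⟨fun i => ?_, fun i => ?_, ?_⟩, ?_⟩
      · change (⋂ A : c, OrderDual.ofDual A.1 i) ∈ S i
        rw [← Set.sInter_range]
        exact h1 i _ (Set.range_subset_iff.2 fun A => (hcP A.2).1 i)
      · refine nonempty_iInter_of_directed_of_finite_inter (h2 i) _ (fun A => (hcP A.2).1 i)
          (fun A => (hcP A.2).2.1 i) fun A B => ?_
        rcases hc.total A.2 B.2 with h | h
        · exact ⟨B, h i, subset_rfl⟩
        · exact ⟨A, subset_rfl, h i⟩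
      · intro j i h x hx
        exact Set.mem_iInter.2 fun A => (hcP A.2).2.2 h x (Set.mem_iInter.1 hx A)
      · intro A hA i
        exact Set.iInter_subset (fun A : c => OrderDual.ofDual A.1 i) ⟨A, hA⟩
  obtain ⟨A, ⟨hAS, hAne, hAf⟩, hmax⟩ := hzorn
  have hmin : ∀ B : ∀ i, Set (X i), (∀ i, B i ∈ S i) → (∀ i, (B i).Nonempty) →
      (∀ ⦃j i : I⦄ (h : j ≤ i), ∀ x ∈ B i, f h x ∈ B j) →
      (∀ i, B i ⊆ OrderDual.ofDual A i) → ∀ i, OrderDual.ofDual A i ⊆ B i :=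
    fun B hB hBne hBf hBA => hmax (y := OrderDual.toDual B) ⟨hB, hBne, hBf⟩ hBA
  generalize OrderDual.ofDual A = A at hAS hAne hAf hmin
  clear hmax
  have hsurj : ∀ ⦃i j : I⦄ (h : i ≤ j), A i ⊆ f h '' A j := by
    have key := hmin (fun i => ⋂ j : Set.Ici i, f j.2 '' A j) (fun i => ?_) (fun i => ?_) ?_ ?_
    · intro i j h
      exact (key i).trans (Set.iInter_subset (fun j : Set.Ici i => f j.2 '' A j) ⟨j, h⟩)
    · rw [← Set.sInter_range]
      exact h1 i _ (Set.range_subset_iff.2 fun j => h4 j.2 _ (hAS j))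
    · have : Nonempty (Set.Ici i) := ⟨⟨i, le_rfl⟩⟩
      refine nonempty_iInter_of_directed_of_finite_inter (h2 i) _ (fun j => h4 j.2 _ (hAS j))
        (fun j => (hAne j).image _) fun j k => ?_
      obtain ⟨l, hjl, hkl⟩ := exists_ge_ge j.1 k.1
      refine ⟨⟨l, j.2.trans hjl⟩, ?_, ?_⟩
      · rintro _ ⟨a, ha, rfl⟩
        exact ⟨f hjl a, hAf hjl a ha, htrans _ _ _⟩
      · rintro _ ⟨a, ha, rfl⟩
        exact ⟨f hkl a, hAf hkl a ha, htrans _ _ _⟩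
    · intro i j h x hx
      refine Set.mem_iInter.2 fun ⟨k, hk⟩ => ?_
      obtain ⟨l, hjl, hkl⟩ := exists_ge_ge j k
      obtain ⟨a, ha, rfl⟩ := Set.mem_iInter.1 hx ⟨l, hjl⟩
      exact ⟨f hkl a, hAf hkl a ha, (htrans hk hkl a).trans (htrans h hjl a).symm⟩
    · intro i x hx
      obtain ⟨a, ha, rfl⟩ := Set.mem_iInter.1 hx ⟨i, le_rfl⟩
      exact (hrefl i le_rfl a).symm ▸ ha
  have hsub : ∀ i, ∀ x ∈ A i, ∀ y ∈ A i, y = x := by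
    intro i x hx y hy
    have key := hmin (fun j => {a ∈ A j | ∀ h : i ≤ j, f h a = x}) (fun j => ?_) (fun j => ?_)
      ?_ (fun j => Set.sep_subset _ _)
    · rw [← hrefl i le_rfl y]
      exact (key i hy).2 le_rfl
    · by_cases h : i ≤ j
      · convert hinter j _ _ (hAS j) (h3 h x) using 1
        ext a
        simp [h]
      · simpa [h] using hAS j
    · by_cases h : i ≤ j
      · obtain ⟨a, ha, hax⟩ := hsurj h hx
        exact ⟨a, ha, fun _ => hax⟩
      · obtain ⟨a, ha⟩ := hAne j
        exact ⟨a, ha, fun h' => absurd h' h⟩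
    · rintro j k h a ⟨ha, hax⟩
      exact ⟨hAf h a ha, fun h' => by rw [htrans, hax]⟩
  choose x hx using hAne
  exact ⟨x, fun j i h => hsub j _ (hx j) _ (hAf h _ (hx i))⟩
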